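/- arXiv:math/0406535 — 2 statements merged into one kernel-verified Lean document; each statement's English description precedes it below -/
import Mathlib

section
/- (Rate for exponentially decaying tails, class Z.) Let α > 0, β ∈ (0,1), Δ > 0, and let ρ : {1,2,…} → (0,∞) satisfy ρ(N)/(α·β^N) → 1 as N → ∞. Define A(n) = min_{1≤N≤⌊n/3⌋} ( ρ(N) + Δ·N/n ). Then A(n) ≍ (log n)/n: there exist constants 0 < C₁ ≤ C₂ < ∞ and n₀ such that C₁·(log n)/n ≤ A(n) ≤ C₂·(log n)/n for all n ≥ n₀. -/
/-- A positive sequence asymptotic to a positive multiple of `β ^ N` is bounded below by a positive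
multiple of `β ^ N`. -/
lemma exists_pos_mul_pow_le_of_tendsto_div {α β : ℝ} (hα : 0 < α) (hβ : 0 < β) {ρ : ℕ → ℝ}
    (hρpos : ∀ N : ℕ, 1 ≤ N → 0 < ρ N)
    (hρ : Filter.Tendsto (fun N : ℕ => ρ N / (α * β ^ N)) Filter.atTop (nhds 1)) :
    ∃ c : ℝ, 0 < c ∧ ∀ N : ℕ, 1 ≤ N → c * β ^ N ≤ ρ N := by
  obtain ⟨K, hK⟩ := (hρ.inv₀ one_ne_zero).bddAbove_range
  have hK' : ∀ N : ℕ, (ρ N / (α * β ^ N))⁻¹ ≤ K := fun N => hK ⟨N, rfl⟩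
  have hK0 : 0 < K := by
    have h1 := hρpos 1 le_rfl
    exact lt_of_lt_of_le (by positivity) (hK' 1)
  refine ⟨α / K, by positivity, fun N hN => ?_⟩
  have h := hK' N
  rw [inv_div, div_le_iff₀ (hρpos N hN)] at h
  rw [div_mul_eq_mul_div, div_le_iff₀ hK0]
  linarith

/-- `x ≤ exp (x / 2)` for every real `x`. -/
lemma le_exp_half (x : ℝ) : x ≤ Real.exp (x / 2) := by
  have h : Real.exp (x / 2) = Real.exp (x / 4) ^ 2 := by
    rw [← Real.exp_nat_mul]; congr 1; push_cast; ring
  rcases le_or_gt x 0 with hx | hx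
  · exact hx.trans (Real.exp_pos _).le
  · nlinarith [Real.add_one_le_exp (x / 4), sq_nonneg (x / 4 - 1)]


/-- Rate for exponentially decaying Fourier tails (class Z): if `ρ(N) ∼ α β^N` with
`β ∈ (0,1)`, then `A(n) = min_{1≤N≤⌊n/3⌋}(ρ(N) + ΔN/n) ≍ (log n)/n`. -/
theorem statement17 (α β Δ : ℝ) (hα : 0 < α) (hβ0 : 0 < β) (hβ1 : β < 1) (hΔ : 0 < Δ)
    (ρ : ℕ → ℝ) (hρpos : ∀ N : ℕ, 1 ≤ N → 0 < ρ N)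
    (hρ : Filter.Tendsto (fun N : ℕ => ρ N / (α * β ^ N)) Filter.atTop (nhds 1)) :
    ∃ C₁ C₂ : ℝ, ∃ n₀ : ℕ, 0 < C₁ ∧ C₁ ≤ C₂ ∧ ∀ n : ℕ, n₀ ≤ n →
      C₁ * Real.log n / n ≤ sInf ((fun N => ρ N + Δ * N / n) '' {N : ℕ | 1 ≤ N ∧ N ≤ n / 3}) ∧
      sInf ((fun N => ρ N + Δ * N / n) '' {N : ℕ | 1 ≤ N ∧ N ≤ n / 3}) ≤ C₂ * Real.log n / n := by
  obtain ⟨c, hc, hcρ⟩ := exists_pos_mul_pow_le_of_tendsto_div hα hβ0 hρpos hρ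
  set L : ℝ := -Real.log β with hL
  have hL0 : 0 < L := neg_pos.2 (Real.log_neg hβ0 hβ1)
  have hpow (N : ℕ) : β ^ N = Real.exp (-(L * N)) := by
    rw [hL, neg_mul, neg_neg, mul_comm, Real.exp_nat_mul, Real.exp_log hβ0]
  obtain ⟨N₀, hN₀⟩ := Filter.eventually_atTop.1
    (hρ.eventually (ge_mem_nhds (show (1 : ℝ) < 2 by norm_num)))
  have hlog : Filter.Tendsto (fun n : ℕ => Real.log n) Filter.atTop Filter.atTop :=
    Real.tendsto_log_atTop.comp tendsto_natCast_atTop_atTop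
  have hlittle := tendsto_natCast_atTop_atTop (R := ℝ) |>.eventually
    (Real.isLittleO_log_id_atTop.bound (show 0 < 1 / (3 * (1 / L + 1)) by positivity))
  obtain ⟨n₀, hn₀⟩ := Filter.eventually_atTop.1
    (((hlog.eventually_ge_atTop 1).and (hlog.eventually_ge_atTop (L * N₀))).and
      (hlittle.and (Filter.eventually_ge_atTop 3)))
  have hC : min c (Δ / (2 * L)) ≤ 2 * α + Δ * (1 / L + 1) := by
    have h : Δ / (2 * L) = Δ * (1 / L) / 2 := by field_simp
    have h' : 0 < Δ * (1 / L) := by positivity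
    refine (min_le_right _ _).trans ?_
    rw [h]
    linarith
  refine ⟨min c (Δ / (2 * L)), 2 * α + Δ * (1 / L + 1), n₀, by positivity, hC, fun n hn => ?_⟩
  obtain ⟨⟨hx1, hxN⟩, hsmall, hn3⟩ := hn₀ n hn
  have hn0 : (0 : ℝ) < n := by exact_mod_cast (show 0 < n by omega)
  have hexp : Real.exp (Real.log n) = n := Real.exp_log hn0
  set x : ℝ := Real.log n with hx
  constructor
  · refine le_csInf ⟨_, 1, ⟨le_rfl, by omega⟩, rfl⟩ ?_
    rintro _ ⟨N, ⟨hN1, -⟩, rfl⟩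
    have hρN := hρpos N hN1
    rcases le_total (L * N) (x / 2) with h | h
    · have h1 : x / n ≤ β ^ N := by
        rw [hpow, div_le_iff₀ hn0, ← hexp, ← Real.exp_add]
        exact (le_exp_half x).trans (Real.exp_le_exp.2 (by linarith))
      have h2 : 0 ≤ Δ * N / n := by positivity
      calc min c (Δ / (2 * L)) * x / n = min c (Δ / (2 * L)) * (x / n) := mul_div_assoc _ _ _
        _ ≤ c * β ^ N := by gcongr; exact min_le_left _ _
        _ ≤ ρ N + Δ * N / n := by linarith [hcρ N hN1]
    · have h1 : Δ / (2 * L) * x ≤ Δ * N := by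
        rw [div_mul_eq_mul_div, div_le_iff₀ (by positivity)]
        nlinarith
      calc min c (Δ / (2 * L)) * x / n ≤ Δ / (2 * L) * x / n := by
            gcongr; exact min_le_right _ _
        _ ≤ Δ * N / n := by gcongr
        _ ≤ ρ N + Δ * N / n := by linarith
  · set N : ℕ := ⌈x / L⌉₊ with hN
    have hNle : x ≤ L * N := by
      rw [mul_comm, ← div_le_iff₀ hL0]; exact Nat.le_ceil _
    have hNlt : (N : ℝ) ≤ (1 / L + 1) * x := by
      have h := (Nat.ceil_lt_add_one (show 0 ≤ x / L by positivity)).le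
      have h' : (1 / L + 1) * x = x / L + x := by ring
      linarith
    have hN1 : 1 ≤ N := Nat.one_le_ceil_iff.2 (by positivity)
    have hNN₀ : N₀ ≤ N := by
      have h : L * N₀ ≤ L * N := hxN.trans hNle
      exact_mod_cast le_of_mul_le_mul_left h hL0
    have hNn : N ≤ n / 3 := by
      rw [Nat.le_div_iff_mul_le (by norm_num)]
      have h1 : x ≤ 1 / (3 * (1 / L + 1)) * n := by
        simpa only [id, Real.norm_of_nonneg hn0.le] using (Real.le_norm_self x).trans hsmall
      have h2 : x * (3 * (1 / L + 1)) ≤ n := by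
        rwa [one_div_mul_eq_div, le_div_iff₀ (by positivity)] at h1
      have h3 : (N : ℝ) * 3 ≤ n := by linarith
      exact_mod_cast h3
    have hβN : β ^ N ≤ x / n := by
      rw [hpow, le_div_iff₀ hn0, ← hexp, ← Real.exp_add]
      exact (Real.exp_le_one_iff.2 (by linarith)).trans hx1
    have hρN : ρ N ≤ 2 * α * β ^ N := by
      have h := hN₀ N hNN₀
      rw [div_le_iff₀ (by positivity)] at h
      linarith
    refine le_trans (csInf_le ?_ ⟨N, ⟨hN1, hNn⟩, rfl⟩) ?_
    · refine ⟨0, ?_⟩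
      rintro _ ⟨M, ⟨hM, -⟩, rfl⟩
      have := hρpos M hM
      positivity
    · calc ρ N + Δ * N / n ≤ 2 * α * (x / n) + Δ * ((1 / L + 1) * x) / n := by
            gcongr; exact hρN.trans (by gcongr)
        _ = (2 * α + Δ * (1 / L + 1)) * x / n := by ring
end

section
/- (Rate for polynomially decaying tails, class W.) Let C₀ > 0, β > 0, α ∈ ℝ, Δ > 0, and let ρ : {2,3,…} → (0,∞) satisfy ρ(N)/(C₀·N^{−2β}·(log N)^α) → 1 as N → ∞. Define A(n) = min_{1≤N≤⌊n/3⌋} ( ρ(N) + Δ·N/n ). Then A(n) ≍ n^{−2β/(2β+1)}·(log n)^{α/(2β+1)}: there exist constants 0 < C₁ ≤ C₂ < ∞ and n₀ such that C₁·n^{−2β/(2β+1)}(log n)^{α/(2β+1)} ≤ A(n) ≤ C₂·n^{−2β/(2β+1)}(log n)^{α/(2β+1)} for all n ≥ n₀. -/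
open Filter Real Topology

lemma tendsto_rpow_neg_mul_log_rpow {a : ℝ} (ha : 0 < a) (b : ℝ) :
    Tendsto (fun t : ℝ => t ^ (-a) * log t ^ b) atTop (𝓝 0) := by
  refine (isLittleO_log_rpow_rpow_atTop b ha).tendsto_div_nhds_zero.congr' ?_
  filter_upwards [eventually_gt_atTop 0] with t ht
  rw [rpow_neg ht.le]
  ring

lemma tendsto_rpow_mul_log_rpow_atTop {a : ℝ} (ha : 0 < a) (b : ℝ) :
    Tendsto (fun t : ℝ => t ^ a * log t ^ b) atTop atTop := by
  have h : Tendsto (fun t : ℝ => t ^ (-a) * log t ^ (-b)) atTop (𝓝[>] 0) := by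
    refine tendsto_nhdsWithin_iff.2 ⟨tendsto_rpow_neg_mul_log_rpow ha (-b), ?_⟩
    filter_upwards [eventually_gt_atTop 1] with t ht
    have := log_pos ht
    simp only [Set.mem_Ioi]
    positivity
  refine h.inv_tendsto_nhdsGT_zero.congr' ?_
  filter_upwards [eventually_gt_atTop 1] with t ht
  have := log_pos ht
  simp only [Pi.inv_apply]
  rw [rpow_neg (by positivity), rpow_neg this.le, mul_inv, inv_inv, inv_inv]

lemma tendsto_log_rpow_mul_log_rpow_div_log (a b : ℝ) :
    Tendsto (fun t : ℝ => log (t ^ a * log t ^ b) / log t) atTop (𝓝 a) := by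
  have h : Tendsto (fun t : ℝ => log (log t) / log t) atTop (𝓝 0) :=
    (isLittleO_log_id_atTop.tendsto_div_nhds_zero).comp tendsto_log_atTop
  have h' : Tendsto (fun t : ℝ => a + b * (log (log t) / log t)) atTop (𝓝 a) := by
    simpa using (h.const_mul b).const_add a
  refine h'.congr' ?_
  filter_upwards [eventually_gt_atTop 1] with t ht
  have := log_pos ht
  rw [log_mul (by positivity) (by positivity), log_rpow (by positivity), log_rpow this]
  field_simp

/-- `t ^ (-c) * (log t) ^ α` is eventually antitone. -/
lemma exists_antitoneOn_rpow_neg_mul_log_rpow {c : ℝ} (hc : 0 < c) (α : ℝ) :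
    ∃ T : ℝ, AntitoneOn (fun t : ℝ => t ^ (-c) * log t ^ α) (Set.Ici T) := by
  rcases le_or_gt α 0 with hα | hα
  · refine ⟨2, fun s hs t _ hst => ?_⟩
    have hs' : (2 : ℝ) ≤ s := hs
    have hls : 0 < log s := log_pos (by linarith)
    have h1 : t ^ (-c) ≤ s ^ (-c) := rpow_le_rpow_of_nonpos (by linarith) hst (by linarith)
    have h2 : log t ^ α ≤ log s ^ α :=
      rpow_le_rpow_of_nonpos hls (log_le_log (by linarith) hst) hα
    have h3 : 0 < log t := log_pos (by linarith)
    exact mul_le_mul h1 h2 (by positivity) (rpow_nonneg (by linarith) _)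
  · have he : 0 < c / α := by positivity
    refine ⟨max 1 (exp (c / α)⁻¹), fun s hs t ht hst => ?_⟩
    have key : ∀ u : ℝ, 1 ≤ u → (log u / u ^ (c / α)) ^ α = u ^ (-c) * log u ^ α := by
      intro u hu
      rw [div_rpow (log_nonneg hu) (by positivity), ← rpow_mul (by positivity),
        div_mul_cancel₀ _ hα.ne', rpow_neg (by positivity)]
      ring
    have hs1 : 1 ≤ s := (le_max_left _ _).trans hs
    have ht1 : 1 ≤ t := (le_max_left _ _).trans ht
    show t ^ (-c) * log t ^ α ≤ s ^ (-c) * log s ^ α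
    rw [← key s hs1, ← key t ht1]
    refine rpow_le_rpow (div_nonneg (log_nonneg ht1) (by positivity)) ?_ hα.le
    exact log_div_self_rpow_antitoneOn he (Set.mem_Ici.2 ((le_max_right _ _).trans hs))
      (Set.mem_Ici.2 ((le_max_right _ _).trans ht)) hst

/-- At the balancing point `x = t ^ (1/(c+1)) (log t) ^ (α/(c+1))`, the tail `x ^ (-c) (log x) ^ α`
is asymptotically a constant multiple of `x / t`. -/
lemma tendsto_tail_div_rate {c : ℝ} (hc : 0 < c) (α : ℝ) :
    Tendsto (fun t : ℝ =>
      ((t ^ (1 / (c + 1)) * log t ^ (α / (c + 1))) ^ (-c) *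
        log (t ^ (1 / (c + 1)) * log t ^ (α / (c + 1))) ^ α) /
      (t ^ (-c / (c + 1)) * log t ^ (α / (c + 1)))) atTop (𝓝 ((1 / (c + 1)) ^ α)) := by
  have hc1 : 0 < 1 / (c + 1) := by positivity
  have h := (tendsto_log_rpow_mul_log_rpow_div_log (1 / (c + 1)) (α / (c + 1))).rpow_const
    (p := α) (Or.inl hc1.ne')
  refine h.congr' ?_
  filter_upwards [eventually_gt_atTop 1, (tendsto_rpow_mul_log_rpow_atTop hc1
    (α / (c + 1))).eventually_gt_atTop 1] with t ht hx
  have hl := log_pos ht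
  have ht0 : 0 < t := by linarith
  rw [div_rpow (log_pos hx).le hl.le, mul_rpow (by positivity) (by positivity),
    ← rpow_mul ht0.le, ← rpow_mul hl.le,
    show 1 / (c + 1) * -c = -c / (c + 1) by ring,
    show α / (c + 1) * -c = α / (c + 1) - α by field_simp; ring, rpow_sub hl]
  field_simp


/-- Rate for polynomially decaying Fourier tails (class W): if
`ρ(N) ∼ C₀ N^{−2β} (log N)^α`, then
`A(n) = min_{1≤N≤⌊n/3⌋}(ρ(N) + ΔN/n) ≍ n^{−2β/(2β+1)} (log n)^{α/(2β+1)}`. -/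
theorem statement18 (C₀ β Δ : ℝ) (α : ℝ) (hC₀ : 0 < C₀) (hβ : 0 < β) (hΔ : 0 < Δ)
    (ρ : ℕ → ℝ) (hρpos : ∀ N : ℕ, 1 ≤ N → 0 < ρ N)
    (hρ : Filter.Tendsto
      (fun N : ℕ => ρ N / (C₀ * (N : ℝ) ^ (-(2 * β)) * Real.log N ^ α))
      Filter.atTop (nhds 1)) :
    ∃ C₁ C₂ : ℝ, ∃ n₀ : ℕ, 0 < C₁ ∧ C₁ ≤ C₂ ∧ ∀ n : ℕ, n₀ ≤ n →
      C₁ * (n : ℝ) ^ (-(2 * β) / (2 * β + 1)) * Real.log n ^ (α / (2 * β + 1))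
          ≤ sInf ((fun N => ρ N + Δ * N / n) '' {N : ℕ | 1 ≤ N ∧ N ≤ n / 3}) ∧
      sInf ((fun N => ρ N + Δ * N / n) '' {N : ℕ | 1 ≤ N ∧ N ≤ n / 3})
          ≤ C₂ * (n : ℝ) ^ (-(2 * β) / (2 * β + 1)) * Real.log n ^ (α / (2 * β + 1)) := by
  set c : ℝ := 2 * β
  have hc : 0 < c := by positivity
  have hc1 : 0 < 1 / (c + 1) := by positivity
  set g : ℝ → ℝ := fun t => t ^ (-c) * log t ^ α with hg
  set x : ℝ → ℝ := fun t => t ^ (1 / (c + 1)) * log t ^ (α / (c + 1)) with hx_def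
  set r : ℝ → ℝ := fun t => t ^ (-c / (c + 1)) * log t ^ (α / (c + 1)) with hr_def
  set k : ℝ := (1 / (c + 1)) ^ α
  have hk : 0 < k := by positivity
  obtain ⟨T, hT⟩ := exists_antitoneOn_rpow_neg_mul_log_rpow hc α
  have hr0 : Tendsto r atTop (𝓝 0) := by
    have := tendsto_rpow_neg_mul_log_rpow (a := c / (c + 1)) (by positivity) (α / (c + 1))
    simpa only [hr_def, neg_div] using this
  have hx : Tendsto x atTop atTop := tendsto_rpow_mul_log_rpow_atTop hc1 _
  have hlim : Tendsto (fun t => g (x t) / r t) atTop (𝓝 k) := tendsto_tail_div_rate hc α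
  obtain ⟨N₀, hN₀⟩ : ∃ N₀ : ℕ, ∀ N : ℕ, N₀ ≤ N →
      T ≤ (N : ℝ) ∧ C₀ / 2 * g N ≤ ρ N ∧ ρ N ≤ 2 * C₀ * g N := by
    refine eventually_atTop.1 ?_
    filter_upwards [hρ.eventually (Ioo_mem_nhds (by norm_num : (1 / 2 : ℝ) < 1) one_lt_two),
      eventually_ge_atTop 2, tendsto_natCast_atTop_atTop.eventually_ge_atTop T] with N hN hN2 hNT
    have hN1 : (1 : ℝ) < N := by exact_mod_cast hN2
    have hl := log_pos hN1
    have hgN : 0 < C₀ * (N : ℝ) ^ (-c) * log N ^ α := by positivity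
    obtain ⟨h1, h2⟩ := hN
    rw [lt_div_iff₀ hgN] at h1
    rw [div_lt_iff₀ hgN] at h2
    refine ⟨hNT, ?_, ?_⟩ <;> simp only [hg] <;> linarith
  obtain ⟨m, hm, hmρ⟩ : ∃ m : ℝ, 0 < m ∧ ∀ N : ℕ, 1 ≤ N → N < N₀ → m ≤ ρ N := by
    rcases (Finset.Ico 1 N₀).eq_empty_or_nonempty with he | hne
    · refine ⟨1, one_pos, fun N h1 h2 => ?_⟩
      have : N ∈ Finset.Ico 1 N₀ := Finset.mem_Ico.2 ⟨h1, h2⟩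
      simp [he] at this
    · obtain ⟨M, hM, hmin⟩ := (Finset.Ico 1 N₀).exists_min_image ρ hne
      exact ⟨ρ M, hρpos M (Finset.mem_Ico.1 hM).1,
        fun N h1 h2 => hmin N (Finset.mem_Ico.2 ⟨h1, h2⟩)⟩
  have hev : ∀ᶠ t : ℝ in atTop, 1 < t ∧ 1 ≤ x t ∧ T ≤ x t ∧ (N₀ : ℝ) ≤ x t ∧ r t < 1 / 6 ∧
      r t < m ∧ k / 2 < g (x t) / r t ∧ g (x t) / r t < 2 * k := by
    filter_upwards [eventually_gt_atTop 1, hx.eventually_ge_atTop 1, hx.eventually_ge_atTop T,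
      hx.eventually_ge_atTop (N₀ : ℝ), hr0.eventually_lt_const (by norm_num : (0 : ℝ) < 1 / 6),
      hr0.eventually_lt_const hm, hlim.eventually_const_lt (half_lt_self hk),
      hlim.eventually_lt_const (by linarith : k < 2 * k)] with t h1 h2 h3 h4 h5 h6 h7 h8
    exact ⟨h1, h2, h3, h4, h5, h6, h7, h8⟩
  obtain ⟨n₀, hn₀⟩ := eventually_atTop.1 (tendsto_natCast_atTop_atTop.eventually hev)
  refine ⟨min (min Δ 1) (C₀ * k / 4), 4 * C₀ * k + 2 * Δ, n₀, by positivity, ?_, ?_⟩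
  · have : 0 < 4 * C₀ * k := by positivity
    linarith [min_le_left (min Δ 1) (C₀ * k / 4), min_le_left Δ 1]
  intro n hn
  obtain ⟨hn1, hx1, hxT, hxN₀, hr6, hrm, hklo, hkhi⟩ := hn₀ n hn
  have hn0 : (0 : ℝ) < n := by linarith
  have hln := log_pos hn1
  have hr : 0 < r n := by simp only [hr_def]; positivity
  have hxr : x n = r n * n := by
    simp only [hx_def, hr_def]
    rw [mul_right_comm, ← rpow_add_one hn0.ne']
    congr 2
    field_simp
    ring
  rw [lt_div_iff₀ hr] at hklo
  rw [div_lt_iff₀ hr] at hkhi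
  rw [mul_assoc, mul_assoc]
  change _ * r n ≤ _ ∧ _ ≤ _ * r n
  set N₁ : ℕ := ⌈x n⌉₊
  have hN₁ : x n ≤ N₁ := Nat.le_ceil _
  have hN₁' : (N₁ : ℝ) ≤ 2 * x n := by
    linarith [Nat.ceil_lt_add_one (zero_le_one.trans hx1)]
  have hmem : N₁ ∈ {N : ℕ | 1 ≤ N ∧ N ≤ n / 3} := by
    refine ⟨by exact_mod_cast hx1.trans hN₁, (Nat.le_div_iff_mul_le (by norm_num)).2 ?_⟩
    have : (N₁ : ℝ) * 3 ≤ n := by nlinarith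
    exact_mod_cast this
  have hlower : ∀ N : ℕ, 1 ≤ N → min (min Δ 1) (C₀ * k / 4) * r n ≤ ρ N + Δ * N / n := by
    intro N hN
    have hterm : 0 ≤ Δ * N / n := by positivity
    have hρN := hρpos N hN
    rcases le_or_gt (x n) N with hxN | hNx
    · have h1 : Δ * r n ≤ Δ * N / n := by
        rw [le_div_iff₀ hn0, mul_assoc, ← hxr]
        gcongr
      have h2 : min (min Δ 1) (C₀ * k / 4) * r n ≤ Δ * r n := by
        gcongr
        exact (min_le_left _ _).trans (min_le_left _ _)
      linarith
    · rcases lt_or_ge N N₀ with hlt | hge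
      · have h2 : min (min Δ 1) (C₀ * k / 4) * r n ≤ 1 * r n := by
          gcongr
          exact (min_le_left _ _).trans (min_le_right _ _)
        linarith [hmρ N hN hlt]
      · obtain ⟨hNT, hlo, -⟩ := hN₀ N hge
        have h1 : g (x n) ≤ g N := hT hNT hxT hNx.le
        have h2 : min (min Δ 1) (C₀ * k / 4) * r n ≤ C₀ * k / 4 * r n := by
          gcongr
          exact min_le_right _ _
        have h3 : C₀ / 2 * (k / 2 * r n) ≤ C₀ / 2 * g N := by
          gcongr
          linarith
        linarith
  constructor
  · refine le_csInf ⟨_, N₁, hmem, rfl⟩ ?_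
    rintro _ ⟨N, hN, rfl⟩
    exact hlower N hN.1
  · refine (csInf_le ?_ (Set.mem_image_of_mem _ hmem)).trans ?_
    · refine ⟨min (min Δ 1) (C₀ * k / 4) * r n, ?_⟩
      rintro _ ⟨N, hN, rfl⟩
      exact hlower N hN.1
    · obtain ⟨hNT, -, hhi⟩ := hN₀ N₁ (by exact_mod_cast hxN₀.trans hN₁)
      have h1 : g N₁ ≤ g (x n) := hT hxT hNT hN₁
      have h2 : 2 * C₀ * g N₁ ≤ 2 * C₀ * (2 * k * r n) := by
        gcongr
        linarith
      have h3 : Δ * N₁ / n ≤ 2 * Δ * r n := by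
        rw [div_le_iff₀ hn0]
        nlinarith
      show ρ N₁ + Δ * N₁ / n ≤ _
      linarith
end
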